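/- Let f be a cusp form of even weight k for SL(2,ℤ) with Fourier coefficients a_f(n), and set A_f(n) = a_f(n)·n^{−(k−1)/2}. If Re(A_f(n)) ≠ 0 for at least one n, then there exists X0 > 0 such that for every X ≥ X0 there exist integers n, m with X < n, m ≤ X + X^{3/5}, Re(A_f(n)) > 0 and Re(A_f(m)) < 0. Likewise, if Im(A_f(n)) ≠ 0 for at least one n, then there exists X0 > 0 such that for every X ≥ X0 there exist integers n, m with X < n, m ≤ X + X^{3/5}, Im(A_f(n)) > 0 and Im(A_f(m)) < 0. -/

import Mathlib

open Complex Filter Asymptotics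

/-- The `(i, j)` entry of `γ ∈ SL(2, ℤ)`, viewed as a complex number. -/
def mEntry (γ : Matrix.SpecialLinearGroup (Fin 2) ℤ) (i j : Fin 2) : ℂ :=
  (((γ : Matrix (Fin 2) (Fin 2) ℤ) i j : ℤ) : ℂ)

/-- `f` is a cusp form of weight `k` for `SL(2, ℤ)` with Fourier coefficients
`a`: it is holomorphic on the upper half-plane, satisfies the weight-`k`
modular transformation law, and has Fourier expansion
`f z = ∑_{n ≥ 1} a n · e^{2πinz}`. -/
def IsCuspFormSL2 (k : ℤ) (f : ℂ → ℂ) (a : ℕ → ℂ) : Prop :=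
  DifferentiableOn ℂ f {z : ℂ | 0 < z.im} ∧
  (∀ γ : Matrix.SpecialLinearGroup (Fin 2) ℤ, ∀ z : ℂ, 0 < z.im →
    f ((mEntry γ 0 0 * z + mEntry γ 0 1) / (mEntry γ 1 0 * z + mEntry γ 1 1))
      = (mEntry γ 1 0 * z + mEntry γ 1 1) ^ k * f z) ∧
  (∀ z : ℂ, 0 < z.im →
    HasSum (fun n : ℕ => a (n + 1) * Complex.exp (2 * Real.pi * Complex.I * (n + 1) * z))
      (f z))

/-- The Deligne-normalized coefficients `A_f(n) = a_f(n) · n^{−(k−1)/2}`. -/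
noncomputable def delCoeff (k : ℤ) (a : ℕ → ℂ) (n : ℕ) : ℂ :=
  a n * (((n : ℝ) ^ (-(((k : ℝ) - 1) / 2)) : ℝ) : ℂ)

/-- `j!` times the generalized Laguerre polynomial `L_j^{(k-1)}`. -/
noncomputable def lagPoly (k : ℕ) : ℕ → Polynomial ℝ
  | 0 => 1
  | j + 1 => (Polynomial.C ((k : ℝ) + j) - Polynomial.X) * lagPoly k j +
      Polynomial.X * Polynomial.derivative (lagPoly k j)

open Polynomial in
lemma lagPoly_derivative_and_ode (k j : ℕ) :
    derivative (lagPoly k (j + 1)) = C ((j : ℝ) + 1) * (derivative (lagPoly k j) - lagPoly k j) ∧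
    X * derivative (derivative (lagPoly k j)) + (C (k : ℝ) - X) * derivative (lagPoly k j) +
      C (j : ℝ) * lagPoly k j = 0 := by
  have step : ∀ i : ℕ, X * derivative (derivative (lagPoly k i)) +
      (C (k : ℝ) - X) * derivative (lagPoly k i) + C (i : ℝ) * lagPoly k i = 0 →
      derivative (lagPoly k (i + 1)) =
        C ((i : ℝ) + 1) * (derivative (lagPoly k i) - lagPoly k i) := by
    intro i hi
    simp only [lagPoly, derivative_mul, derivative_sub, derivative_C,
      derivative_X, map_add, map_one]
    linear_combination hi
  have ode : X * derivative (derivative (lagPoly k j)) +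
      (C (k : ℝ) - X) * derivative (lagPoly k j) + C (j : ℝ) * lagPoly k j = 0 := by
    induction j with
    | zero => simp [lagPoly]
    | succ i ih =>
      rw [step i ih]
      simp only [derivative_mul, derivative_sub, derivative_one, derivative_C, lagPoly,
        Nat.cast_add,
        Nat.cast_one, map_add, map_one]
      linear_combination (C (i : ℝ) + 1) * ih
  exact ⟨step j ode, ode⟩

/-- The value of the derivative of `lagPoly k j`. -/
noncomputable def lagDer (k j : ℕ) (x : ℝ) : ℝ := (Polynomial.derivative (lagPoly k j)).eval x

lemma lagPoly_succ_eval (k j : ℕ) (x : ℝ) :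
    (lagPoly k (j + 1)).eval x = (k + j - x) * (lagPoly k j).eval x + x * lagDer k j x := by
  simp [lagPoly, lagDer]

lemma lagDer_succ (k j : ℕ) (x : ℝ) :
    lagDer k (j + 1) x = (j + 1) * (lagDer k j x - (lagPoly k j).eval x) := by
  simp [lagDer, (lagPoly_derivative_and_ode k j).1]

lemma hasDerivAt_lagDer (k j : ℕ) {x : ℝ} (hx : x ≠ 0) :
    HasDerivAt (lagDer k j)
      ((-(k - x) * lagDer k j x - j * (lagPoly k j).eval x) / x) x := by
  have h := congrArg (Polynomial.eval x) (lagPoly_derivative_and_ode k j).2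
  have h2 := (Polynomial.derivative (lagPoly k j)).hasDerivAt x
  simp only [Polynomial.eval_add, Polynomial.eval_mul, Polynomial.eval_X, Polynomial.eval_sub,
    Polynomial.eval_C, Polynomial.eval_zero] at h
  refine HasDerivAt.congr_deriv h2 ?_
  rw [eq_div_iff hx]
  simp only [lagDer]
  linear_combination h

lemma lagPoly_eval_near_zero {k : ℕ} (hk : 2 ≤ k) (j : ℕ) {x : ℝ} (hx : 0 ≤ x)
    (hxj : x * (2 * j + 1) ≤ 1) :
    (j.factorial : ℝ) ≤ (lagPoly k j).eval x ∧ lagDer k j x ≤ 0 ∧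
      -(2 * j * (lagPoly k j).eval x) ≤ lagDer k j x := by
  have hk' : (2 : ℝ) ≤ k := by exact_mod_cast hk
  induction j with
  | zero => simp [lagPoly, lagDer]
  | succ i ih =>
    push_cast at hxj
    obtain ⟨h1, h2, h3⟩ := ih (by nlinarith)
    have hf : (0 : ℝ) < i.factorial := by positivity
    have hi : (0 : ℝ) ≤ i := by positivity
    set p := (lagPoly k i).eval x
    set d := lagDer k i x
    have hp : 0 < p := by linarith
    have key : (i + 1) * p ≤ (k + i - x) * p + x * d := by
      have : x * (2 * i + 1) * p ≤ 1 * p := by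
        apply mul_le_mul_of_nonneg_right _ hp.le; nlinarith
      nlinarith [mul_le_mul_of_nonneg_left h3 hx]
    rw [lagPoly_succ_eval, lagDer_succ]
    refine ⟨?_, ?_, ?_⟩
    · rw [Nat.factorial_succ]; push_cast
      nlinarith
    · nlinarith
    · push_cast
      nlinarith

/-- The Sonin-type energy of `lagPoly k j`, weighted so that it increases. -/
noncomputable def lagEnergy (k j : ℕ) (x : ℝ) : ℝ :=
  x ^ (2 * k - 1) * Real.exp (-x) * ((j + k / 2 - x / 4) * (lagPoly k j).eval x ^ 2 +
    x * (lagDer k j x - (lagPoly k j).eval x / 2) ^ 2)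

lemma lagEnergy_monotoneOn {k : ℕ} (hk : 2 ≤ k) (j : ℕ) :
    MonotoneOn (lagEnergy k j) (Set.Ioc 0 (j : ℝ)) := by
  have hder : ∀ x : ℝ, 0 < x → HasDerivAt (lagEnergy k j)
      (x ^ (2 * k - 2) * Real.exp (-x) * (((2 * k - 1) * (j + k / 2 - x / 4) - x / 4) *
        (lagPoly k j).eval x ^ 2)) x := by
    intro x hx
    have hp : HasDerivAt (fun y => (lagPoly k j).eval y) (lagDer k j x) x :=
      (lagPoly k j).hasDerivAt x
    have hd := hasDerivAt_lagDer k j hx.ne'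
    have h1 : HasDerivAt (fun y : ℝ => y ^ (2 * k - 1))
        (((2 * k - 1 : ℕ) : ℝ) * x ^ (2 * k - 1 - 1)) x :=
      hasDerivAt_pow _ _
    have h2 : HasDerivAt (fun y : ℝ => Real.exp (-y)) (Real.exp (-x) * (-1)) x :=
      (hasDerivAt_id x).neg.exp
    have h3 : HasDerivAt (fun y : ℝ => ((j : ℝ) + k / 2 - y / 4)) (-(1 / 4)) x :=
      ((hasDerivAt_id x).div_const 4).const_sub _
    have h := (h1.mul h2).mul ((h3.mul (hp.pow 2)).add
      ((hasDerivAt_id x).mul ((hd.sub (hp.div_const 2)).pow 2)))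
    refine HasDerivAt.congr_deriv (f := lagEnergy k j) h ?_
    have e1 : 2 * k - 1 - 1 = 2 * k - 2 := by omega
    have e2 : x ^ (2 * k - 1) = x ^ (2 * k - 2) * x := by
      rw [← pow_succ]; congr 1; omega
    have e3 : ((2 * k - 1 : ℕ) : ℝ) = 2 * k - 1 := by
      rw [Nat.cast_sub (by omega)]; push_cast; ring
    simp only [Pi.mul_apply, Pi.add_apply, Pi.sub_apply, Pi.pow_apply, id, e1, e2, e3]
    field_simp
    ring
  refine monotoneOn_of_deriv_nonneg (convex_Ioc _ _) ?_ ?_ ?_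
  · exact fun x hx => (hder x hx.1).continuousAt.continuousWithinAt
  · intro x hx
    rw [interior_Ioc] at hx
    exact (hder x hx.1).differentiableAt.differentiableWithinAt
  · intro x hx
    rw [interior_Ioc] at hx
    rw [(hder x hx.1).deriv]
    have hk' : (2 : ℝ) ≤ k := by exact_mod_cast hk
    have hx0 := hx.1
    have hx1 := hx.2
    have : 0 ≤ (2 * k - 1) * (j + k / 2 - x / 4) - x / 4 := by nlinarith
    positivity

/-- A quantitative Turán inequality for `lagPoly`. -/
lemma lagPoly_turan {k : ℕ} (hk : 2 ≤ k) {j : ℕ} (hj : k ^ 2 ≤ j) {x : ℝ} (hx : 4 ≤ x)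
    (hxj : x ≤ j) :
    (j.factorial : ℝ) ^ 2 * (1 / (2 * j + 1)) ^ (2 * k) * Real.exp x / (100 * x ^ (2 * k)) ≤
      (lagPoly k (j + 1)).eval x ^ 2 - (lagPoly k j).eval x * (lagPoly k (j + 2)).eval x := by
  have hk' : (2 : ℝ) ≤ k := by exact_mod_cast hk
  have hj' : (k : ℝ) ^ 2 ≤ j := by exact_mod_cast hj
  have hj1 : (4 : ℝ) ≤ j := hx.trans hxj
  -- the form dominates the energy
  have h1 : Real.exp x * x * lagEnergy k j x / x ^ (2 * k - 1) / 8 ≤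
      (lagPoly k (j + 1)).eval x ^ 2 - (lagPoly k j).eval x * (lagPoly k (j + 2)).eval x := by
    have hE : Real.exp x * x * lagEnergy k j x / x ^ (2 * k - 1) =
        x * ((j + k / 2 - x / 4) * (lagPoly k j).eval x ^ 2 +
          x * (lagDer k j x - (lagPoly k j).eval x / 2) ^ 2) := by
      rw [lagEnergy, Real.exp_neg]
      field_simp
    rw [hE, show j + 2 = (j + 1) + 1 from rfl, lagPoly_succ_eval k (j + 1), lagDer_succ,
      lagPoly_succ_eval]
    push_cast
    set p := (lagPoly k j).eval x
    set r := x * (lagDer k j x - p / 2) with hr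
    have hd : x * lagDer k j x = r + x * p / 2 := by rw [hr]; ring
    have h2 : (((k : ℝ) + j - x) * p + x * lagDer k j x) ^ 2 -
        p * ((k + (j + 1) - x) * ((k + j - x) * p + x * lagDer k j x) +
          x * ((j + 1) * (lagDer k j x - p))) =
        r ^ 2 + (k - 2) * p * r + p ^ 2 * ((j + 1 + k / 2) * x - k - j - x ^ 2 / 4) := by
      linear_combination (x * lagDer k j x + r + x * p / 2 + 2 * p * (k + j - x)
        - p * (k + (j + 1) - x) - p * (j + 1)) * hd
    have h3 : x * ((j + k / 2 - x / 4) * p ^ 2 + x * (lagDer k j x - p / 2) ^ 2) =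
        x * (j + k / 2 - x / 4) * p ^ 2 + r ^ 2 := by rw [hr]; ring
    rw [h2, h3]
    have hkj : (k : ℝ) ≤ j := by nlinarith
    have h4 : x * (j + k / 2 - x / 4) ≤ 2 * j * x := by
      rw [mul_comm]
      exact mul_le_mul_of_nonneg_right (by linarith) (by linarith)
    have h5 : j * x / 4 + (k - 2) ^ 2 / 2 ≤ (j + 1 + k / 2) * x - k - j - x ^ 2 / 4 := by
      nlinarith
    have h6 := mul_le_mul_of_nonneg_right h4 (sq_nonneg p)
    have h7 := mul_le_mul_of_nonneg_right h5 (sq_nonneg p)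
    nlinarith [sq_nonneg (r + (k - 2) * p), sq_nonneg r]
  refine le_trans ?_ h1
  -- the energy at a small point
  set x₀ : ℝ := 1 / (2 * j + 1) with hx₀
  have hx₀p : 0 < x₀ := by positivity
  have hx₀1 : x₀ ≤ 1 := by rw [hx₀, div_le_one (by positivity)]; linarith
  have hmono := lagEnergy_monotoneOn hk j ⟨hx₀p, by linarith⟩
    (⟨by linarith, hxj⟩ : x ∈ Set.Ioc 0 (j : ℝ)) (by linarith)
  have hlow : (j.factorial : ℝ) ^ 2 * x₀ ^ (2 * k) / 3 ≤ lagEnergy k j x₀ := by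
    have hp := (lagPoly_eval_near_zero hk j hx₀p.le (by rw [hx₀]; field_simp; rfl)).1
    have he : (1 : ℝ) / 3 ≤ Real.exp (-x₀) := by
      have : Real.exp (-1) ≤ Real.exp (-x₀) := Real.exp_le_exp.2 (by linarith)
      have h := Real.exp_one_lt_d9
      rw [Real.exp_neg] at this
      refine le_trans ?_ this
      rw [one_div]
      exact inv_anti₀ (Real.exp_pos _) (by linarith)
    have hpow : x₀ ^ (2 * k) ≤ x₀ ^ (2 * k - 1) :=
      pow_le_pow_of_le_one hx₀p.le hx₀1 (by omega)
    have hb : (j.factorial : ℝ) ^ 2 ≤ (j + k / 2 - x₀ / 4) * (lagPoly k j).eval x₀ ^ 2 +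
        x₀ * (lagDer k j x₀ - (lagPoly k j).eval x₀ / 2) ^ 2 := by
      have h1 : (j.factorial : ℝ) ^ 2 ≤ (lagPoly k j).eval x₀ ^ 2 := by gcongr
      have h2 : 0 ≤ x₀ * (lagDer k j x₀ - (lagPoly k j).eval x₀ / 2) ^ 2 := by positivity
      have h3 : (1 : ℝ) ≤ j + k / 2 - x₀ / 4 := by linarith
      nlinarith [sq_nonneg ((lagPoly k j).eval x₀)]
    calc (j.factorial : ℝ) ^ 2 * x₀ ^ (2 * k) / 3
        = x₀ ^ (2 * k) * (1 / 3) * (j.factorial : ℝ) ^ 2 := by ring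
      _ ≤ lagEnergy k j x₀ := by rw [lagEnergy]; gcongr
  have hxp : 0 < x := by linarith
  have e2 : x ^ (2 * k) = x ^ (2 * k - 1) * x := by
    rw [← pow_succ]; congr 1; omega
  have hA : 0 ≤ (j.factorial : ℝ) ^ 2 * x₀ ^ (2 * k) := by positivity
  calc (j.factorial : ℝ) ^ 2 * x₀ ^ (2 * k) * Real.exp x / (100 * x ^ (2 * k))
      = ((j.factorial : ℝ) ^ 2 * x₀ ^ (2 * k) / 100) * (Real.exp x / (x ^ (2 * k - 1) * x)) := by
        rw [e2]; field_simp
    _ ≤ (lagEnergy k j x / 8) * (Real.exp x * x / (x ^ (2 * k - 1))) := by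
        have : Real.exp x / (x ^ (2 * k - 1) * x) ≤ Real.exp x * x / (x ^ (2 * k - 1)) := by
          rw [div_le_div_iff₀ (by positivity) (by positivity)]
          have h1 : 0 ≤ Real.exp x * x ^ (2 * k - 1) := by positivity
          have h2 : 1 ≤ x * x := by nlinarith
          nlinarith [mul_le_mul_of_nonneg_left h2 h1]
        apply mul_le_mul _ this (by positivity) (by linarith)
        linarith
    _ = _ := by ring

/-- Polynomial boundedness of a sequence. -/
def PolyBounded (b : ℕ → ℝ) : Prop := ∃ C : ℝ, ∃ K : ℕ, ∀ n : ℕ, |b n| ≤ C * (n : ℝ) ^ K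

/-- The series `∑ b n e^{-2πnw}`, i.e. a Fourier series on the right half-plane. -/
noncomputable def expSeries (b : ℕ → ℝ) (w : ℂ) : ℂ :=
  ∑' n : ℕ, (b n : ℂ) * Complex.exp (-(2 * Real.pi * n * w))

lemma norm_expSeries_term (b : ℕ → ℝ) (n : ℕ) (w : ℂ) :
    ‖(b n : ℂ) * Complex.exp (-(2 * Real.pi * n * w))‖ =
      |b n| * Real.exp (-(2 * Real.pi * n * w.re)) := by
  rw [norm_mul, Complex.norm_real, Complex.norm_exp, Real.norm_eq_abs]
  congr 2
  have : (2 * (Real.pi : ℂ) * n * w) = ((2 * Real.pi * n : ℝ) : ℂ) * w := by push_cast; ring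
  rw [this, Complex.neg_re, Complex.re_ofReal_mul]

lemma PolyBounded.summable {b : ℕ → ℝ} (hb : PolyBounded b) {ρ : ℝ} (hρ : 0 < ρ) :
    Summable fun n : ℕ => |b n| * Real.exp (-(2 * Real.pi * n * ρ)) := by
  obtain ⟨C, K, hC⟩ := hb
  have h := (Real.summable_pow_mul_exp_neg_nat_mul K (r := 2 * Real.pi * ρ)
    (by positivity)).mul_left C
  refine Summable.of_nonneg_of_le (fun n => by positivity) (fun n => ?_) h
  have e : -(2 * Real.pi * n * ρ) = -(2 * Real.pi * ρ) * n := by ring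
  rw [e, ← mul_assoc]
  exact mul_le_mul_of_nonneg_right (hC n) (Real.exp_pos _).le

lemma PolyBounded.summable_complex {b : ℕ → ℝ} (hb : PolyBounded b) {w : ℂ} (hw : 0 < w.re) :
    Summable fun n : ℕ => (b n : ℂ) * Complex.exp (-(2 * Real.pi * n * w)) := by
  refine Summable.of_norm ?_
  simpa only [norm_expSeries_term] using hb.summable hw

lemma PolyBounded.mul_pow {b : ℕ → ℝ} (hb : PolyBounded b) (i : ℕ) :
    PolyBounded fun n => b n * (-(2 * Real.pi * n)) ^ i := by
  obtain ⟨C, K, hC⟩ := hb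
  refine ⟨C * (2 * Real.pi) ^ i, K + i, fun n => ?_⟩
  have : |(-(2 * Real.pi * n)) ^ i| = (2 * Real.pi) ^ i * (n : ℝ) ^ i := by
    rw [abs_pow, abs_neg, abs_of_nonneg (by positivity), _root_.mul_pow]
  rw [abs_mul, this]
  calc |b n| * ((2 * Real.pi) ^ i * (n : ℝ) ^ i)
      ≤ C * (n : ℝ) ^ K * ((2 * Real.pi) ^ i * (n : ℝ) ^ i) := by gcongr; exact hC n
    _ = _ := by ring

lemma hasDerivAt_expSeries {b : ℕ → ℝ} (hb : PolyBounded b) {w : ℂ} (hw : 0 < w.re) :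
    HasDerivAt (expSeries b) (expSeries (fun n => b n * (-(2 * Real.pi * n))) w) w := by
  have hρ : 0 < w.re / 2 := by linarith
  have hopen : IsOpen {z : ℂ | w.re / 2 < z.re} := isOpen_lt continuous_const continuous_re
  have hd : ∀ n : ℕ, ∀ z : ℂ, HasDerivAt
      (fun z : ℂ => (b n : ℂ) * Complex.exp (-(2 * Real.pi * n * z)))
      ((b n : ℂ) * (Complex.exp (-(2 * Real.pi * n * z)) * (-(2 * Real.pi * n)))) z := by
    intro n z
    have h : HasDerivAt (fun z : ℂ => -(2 * Real.pi * n * z)) (-(2 * Real.pi * n)) z := by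
      exact HasDerivAt.congr_deriv (f := fun z : ℂ => -(2 * Real.pi * n * z))
        (((hasDerivAt_id z).const_mul (2 * (Real.pi : ℂ) * n)).neg) (by simp)
    exact h.cexp.const_mul _
  have hbd : ∀ n : ℕ, ∀ z ∈ {z : ℂ | w.re / 2 < z.re},
      ‖(b n : ℂ) * Complex.exp (-(2 * Real.pi * n * z))‖ ≤
        |b n| * Real.exp (-(2 * Real.pi * n * (w.re / 2))) := by
    intro n z hz
    rw [norm_expSeries_term]
    have : w.re / 2 ≤ z.re := le_of_lt hz
    gcongr
  have hdo : ∀ n : ℕ, DifferentiableOn ℂ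
      (fun z : ℂ => (b n : ℂ) * Complex.exp (-(2 * Real.pi * n * z)))
      {z : ℂ | w.re / 2 < z.re} :=
    fun n z _ => (hd n z).differentiableAt.differentiableWithinAt
  have hwm : w ∈ {z : ℂ | w.re / 2 < z.re} := by
    simp only [Set.mem_ofPred_eq]; linarith
  have h1 := Complex.hasSum_deriv_of_summable_norm (hb.summable hρ) hdo hopen hbd hwm
  have h2 := (Complex.differentiableOn_tsum_of_summable_norm
    (hb.summable hρ) hdo hopen hbd).differentiableAt
    (hopen.mem_nhds hwm)
  refine HasDerivAt.congr_deriv (f := expSeries b) h2.hasDerivAt ?_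
  rw [← h1.tsum_eq, expSeries]
  refine tsum_congr fun n => ?_
  rw [(hd n w).deriv]
  push_cast
  ring

lemma iteratedDeriv_expSeries {b : ℕ → ℝ} (hb : PolyBounded b) (i : ℕ) {w : ℂ} (hw : 0 < w.re) :
    iteratedDeriv i (expSeries b) w =
      expSeries (fun n => b n * (-(2 * Real.pi * n)) ^ i) w := by
  induction i generalizing w with
  | zero => simp
  | succ i ih =>
    rw [iteratedDeriv_succ]
    have : iteratedDeriv i (expSeries b) =ᶠ[nhds w]
        expSeries (fun n => b n * (-(2 * Real.pi * n)) ^ i) := by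
      filter_upwards [(isOpen_lt continuous_const continuous_re).mem_nhds hw] with z hz
      exact ih hz
    rw [this.deriv_eq, (hasDerivAt_expSeries (hb.mul_pow i) hw).deriv]
    simp only [pow_succ, mul_assoc]

lemma norm_expSeries_le {b : ℕ → ℝ} (hb : PolyBounded b) {M : ℕ} (hM : ∀ n < M, b n = 0) :
    ∃ D : ℝ, 0 ≤ D ∧ ∀ w : ℂ, 1 ≤ w.re →
      ‖expSeries b w‖ ≤ D * Real.exp (-(2 * Real.pi * M * w.re)) := by
  refine ⟨Real.exp (2 * Real.pi * M) * ∑' n : ℕ, |b n| * Real.exp (-(2 * Real.pi * n * 1)),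
    by positivity, fun w hw => ?_⟩
  have hw0 : 0 < w.re := by linarith
  have hs := hb.summable hw0
  have hs1 := hb.summable one_pos
  calc ‖expSeries b w‖ ≤ ∑' n : ℕ, |b n| * Real.exp (-(2 * Real.pi * n * w.re)) := by
        rw [expSeries]
        simp only [← norm_expSeries_term] at hs ⊢
        exact norm_tsum_le_tsum_norm hs
    _ ≤ ∑' n : ℕ, (Real.exp (2 * Real.pi * M) * Real.exp (-(2 * Real.pi * M * w.re))) *
          (|b n| * Real.exp (-(2 * Real.pi * n * 1))) := by
        refine hs.tsum_le_tsum (fun n => ?_) (hs1.mul_left _)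
        rcases lt_or_ge n M with hn | hn
        · simp [hM n hn]
        · have hn' : (M : ℝ) ≤ n := by exact_mod_cast hn
          have : Real.exp (-(2 * Real.pi * n * w.re)) ≤ Real.exp (2 * Real.pi * M) *
              Real.exp (-(2 * Real.pi * M * w.re)) * Real.exp (-(2 * Real.pi * n * 1)) := by
            rw [← Real.exp_add, ← Real.exp_add]
            apply Real.exp_le_exp.2
            have := mul_nonneg (mul_nonneg Real.pi_pos.le (sub_nonneg.2 hn')) (sub_nonneg.2 hw)
            nlinarith
          calc _ ≤ |b n| * _ := mul_le_mul_of_nonneg_left this (abs_nonneg _)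
            _ = _ := by ring
    _ = _ := by rw [tsum_mul_left]; ring

/-- Cauchy's estimate on a disc almost tangent to the imaginary axis, for functions that
are exponentially small near the origin. -/
lemma norm_iteratedDeriv_le_of_horocycle {g : ℂ → ℂ}
    (hg : DifferentiableOn ℂ g {w : ℂ | 0 < w.re}) {D : ℝ} (hD : 0 ≤ D) {k M : ℕ}
    (hb : ∀ w : ℂ, 0 < w.re → 1 ≤ (w⁻¹).re →
      ‖g w‖ ≤ D * (‖w‖ ^ k)⁻¹ * Real.exp (-(2 * Real.pi * M * (w⁻¹).re)))
    {Y : ℝ} (hY : 0 < Y) (hY2 : Y ≤ 1 / 2) {J i : ℕ} (hJ : 1 ≤ J) (hi : i ≤ J) :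
    Y ^ i * ‖iteratedDeriv i g (Y : ℂ)‖ ≤
      i.factorial * (2 * D * (2 * J / Y) ^ k * Real.exp (-(Real.pi * M / Y))) := by
  have hJ' : (1 : ℝ) ≤ J := by exact_mod_cast hJ
  have hi' : (i : ℝ) ≤ J := by exact_mod_cast hi
  have hJinv : 1 / (2 * (J : ℝ)) ≤ 1 / 2 := by
    apply one_div_le_one_div_of_le <;> linarith
  have hJinv0 : 0 < 1 / (2 * (J : ℝ)) := by positivity
  set r : ℝ := Y * (1 - 1 / (2 * J)) with hr
  have hr0 : 0 < r := mul_pos hY (by linarith)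
  have hrY : r < Y := by rw [hr]; nlinarith
  have hre : ∀ w ∈ Metric.closedBall (Y : ℂ) r, 0 < w.re := by
    intro w hw
    have h1 := (Complex.abs_re_le_norm (w - Y)).trans (mem_closedBall_iff_norm.1 hw)
    rw [Complex.sub_re, Complex.ofReal_re] at h1
    linarith [(abs_le.1 h1).1]
  have hbound : ∀ w ∈ Metric.sphere (Y : ℂ) r,
      ‖g w‖ ≤ D * (2 * J / Y) ^ k * Real.exp (-(Real.pi * M / Y)) := by
    intro w hw
    have hwc := Metric.sphere_subset_closedBall hw
    have hw0 := hre w hwc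
    have hn : ‖w - Y‖ = r := mem_sphere_iff_norm.1 hw
    have hsq : Complex.normSq w ≤ 2 * Y * w.re := by
      have h1 : Complex.normSq (w - Y) = r ^ 2 := by rw [Complex.normSq_eq_norm_sq, hn]
      rw [Complex.normSq_apply] at h1 ⊢
      simp only [Complex.sub_re, Complex.ofReal_re, Complex.sub_im, Complex.ofReal_im] at h1
      nlinarith
    have hpos : 0 < Complex.normSq w := Complex.normSq_pos.2 fun h => by simp [h] at hw0
    have hinv : 1 / (2 * Y) ≤ (w⁻¹).re := by
      rw [Complex.inv_re, div_le_div_iff₀ (by positivity) hpos]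
      linarith
    have h1 : 1 ≤ (w⁻¹).re := by
      refine le_trans ?_ hinv
      rw [le_div_iff₀ (by positivity)]; linarith
    refine (hb w hw0 h1).trans ?_
    have hwn : Y / (2 * J) ≤ ‖w‖ := by
      have h2 := norm_sub_norm_le (Y : ℂ) (Y - w)
      rw [norm_sub_rev (Y : ℂ) w, hn, Complex.norm_real, Real.norm_of_nonneg hY.le] at h2
      have h3 : Y - r = Y / (2 * J) := by rw [hr]; ring
      simpa [h3] using h2
    have h4 : (‖w‖ ^ k)⁻¹ ≤ (2 * J / Y) ^ k := by
      rw [← inv_pow, ← inv_div Y (2 * (J : ℝ))]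
      have : 0 < Y / (2 * J) := by positivity
      gcongr
    have h5 : Real.exp (-(2 * Real.pi * M * (w⁻¹).re)) ≤ Real.exp (-(Real.pi * M / Y)) := by
      apply Real.exp_le_exp.2
      have : 2 * Real.pi * M * (1 / (2 * Y)) ≤ 2 * Real.pi * M * (w⁻¹).re := by gcongr
      have e : 2 * Real.pi * M * (1 / (2 * Y)) = Real.pi * M / Y := by field_simp
      linarith
    gcongr
  have hC := Complex.norm_iteratedDeriv_le_of_forall_mem_sphere_norm_le i hr0
    (hg.diffContOnCl_ball hre) hbound
  have hpow : (1 : ℝ) / 2 ≤ (1 - 1 / (2 * J)) ^ i := by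
    have h := one_add_mul_le_pow (a := -(1 / (2 * (J : ℝ)))) (by linarith) i
    rw [← sub_eq_add_neg] at h
    refine le_trans ?_ h
    have : (i : ℝ) * (1 / (2 * J)) ≤ J * (1 / (2 * J)) := by gcongr
    have e : (J : ℝ) * (1 / (2 * J)) = 1 / 2 := by field_simp
    linarith
  have hri : r ^ i = Y ^ i * (1 - 1 / (2 * J)) ^ i := by rw [hr, mul_pow]
  rw [le_div_iff₀ (by positivity), hri] at hC
  have hN : 0 ≤ Y ^ i * ‖iteratedDeriv i g (Y : ℂ)‖ := by positivity
  nlinarith [mul_le_mul_of_nonneg_left hpow hN]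

/-- The function `w^{-k} e^{-β/w}`. -/
noncomputable def expInv (k : ℕ) (β : ℝ) (w : ℂ) : ℂ := (w ^ k)⁻¹ * Complex.exp (-(β / w))

lemma iteratedDeriv_expInv (k : ℕ) (β : ℝ) (i : ℕ) {w : ℂ} (hw : w ≠ 0) :
    iteratedDeriv i (expInv k β) w = (-1) ^ i * ((w ^ (k + i))⁻¹ * Complex.exp (-(β / w)) *
      Polynomial.aeval ((β : ℂ) / w) (lagPoly k i)) := by
  induction i generalizing w with
  | zero => simp [lagPoly, expInv]
  | succ i ih =>
    rw [iteratedDeriv_succ]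
    have : iteratedDeriv i (expInv k β) =ᶠ[nhds w] fun w => (-1) ^ i * ((w ^ (k + i))⁻¹ *
        Complex.exp (-(β / w)) * Polynomial.aeval ((β : ℂ) / w) (lagPoly k i)) := by
      filter_upwards [isOpen_ne.mem_nhds hw] with z hz
      exact ih hz
    rw [this.deriv_eq]
    have h0 : HasDerivAt (fun w : ℂ => (β : ℂ) / w) (-(β / w ^ 2)) w := by
      have := (hasDerivAt_inv hw).const_mul (β : ℂ)
      refine (this.congr_deriv (by field_simp)).congr_of_eventuallyEq
        (Eventually.of_forall fun z => ?_)
      simp [div_eq_mul_inv]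
    have h1 : HasDerivAt (fun w : ℂ => (w ^ (k + i))⁻¹)
        (-((k + i : ℕ) : ℂ) * (w ^ (k + i + 1))⁻¹) w := by
      refine ((hasDerivAt_pow (k + i) w).inv (pow_ne_zero _ hw)).congr_deriv ?_
      rcases Nat.eq_zero_or_pos (k + i) with h | h
      · simp [h]
      · obtain ⟨m, hm⟩ := Nat.exists_eq_succ_of_ne_zero h.ne'
        rw [hm]
        simp only [Nat.succ_eq_add_one, Nat.add_sub_cancel]
        field_simp
        ring
    have h2 := h0.neg.cexp
    have h3 := (Polynomial.hasDerivAt_aeval (lagPoly k i) ((β : ℂ) / w)).comp w h0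
    have h := (((h1.mul h2).mul h3).const_mul ((-1 : ℂ) ^ i)).deriv
    refine Eq.trans h ?_
    simp only [lagPoly, map_add, map_mul, map_sub, Polynomial.aeval_C, Polynomial.aeval_X,
      Function.comp, Pi.mul_apply, Pi.neg_apply, Complex.coe_algebraMap]
    push_cast
    field_simp
    ring

lemma iteratedDeriv_expInv_ofReal (k : ℕ) (β : ℝ) (i : ℕ) {Y : ℝ} (hY : Y ≠ 0) :
    (-(Y : ℂ)) ^ i * iteratedDeriv i (expInv k β) (Y : ℂ) =
      (((Y ^ k)⁻¹ * Real.exp (-(β / Y)) * (lagPoly k i).eval (β / Y) : ℝ) : ℂ) := by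
  have hY' : (Y : ℂ) ≠ 0 := by exact_mod_cast hY
  have e : Polynomial.aeval ((β : ℂ) / Y) (lagPoly k i) =
      (((lagPoly k i).eval (β / Y) : ℝ) : ℂ) := by
    rw [← Complex.ofReal_div, ← Complex.coe_algebraMap,
      Polynomial.aeval_algebraMap_apply_eq_algebraMap_eval]
  rw [iteratedDeriv_expInv k β i hY', e]
  push_cast
  have : (-(Y : ℂ)) ^ i = (-1) ^ i * (Y : ℂ) ^ i := by rw [← mul_pow]; simp
  rw [this, pow_add]
  have h1 : ((-1 : ℂ) ^ i) * (-1) ^ i = 1 := by rw [← mul_pow]; simp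
  field_simp
  linear_combination ((lagPoly k i).eval (β / Y) : ℝ) * h1

lemma expSeries_eq_add_update {b : ℕ → ℝ} (hb : PolyBounded b) (m : ℕ) {w : ℂ} (hw : 0 < w.re) :
    expSeries b w = b m * Complex.exp (-(2 * Real.pi * m * w)) +
      expSeries (Function.update b m 0) w := by
  rw [expSeries, (hb.summable_complex hw).tsum_eq_add_tsum_ite m, expSeries]
  congr 1
  refine tsum_congr fun n => ?_
  by_cases h : n = m
  · simp [h]
  · simp [h]

lemma PolyBounded.update {b : ℕ → ℝ} (hb : PolyBounded b) (m : ℕ) :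
    PolyBounded (Function.update b m 0) := by
  obtain ⟨C, K, hC⟩ := hb
  refine ⟨C, K, fun n => ?_⟩
  by_cases h : n = m
  · subst h
    simpa using (abs_nonneg _).trans (hC n)
  · simpa [h] using hC n

lemma differentiableOn_expSeries {b : ℕ → ℝ} (hb : PolyBounded b) :
    DifferentiableOn ℂ (expSeries b) {w : ℂ | 0 < w.re} :=
  fun _ hw => (hasDerivAt_expSeries hb hw).differentiableAt.differentiableWithinAt

lemma differentiableOn_expInv (k : ℕ) (β : ℝ) :
    DifferentiableOn ℂ (expInv k β) {w : ℂ | 0 < w.re} := by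
  intro w hw
  have h0 : w ≠ 0 := by
    rintro rfl
    simp at hw
  unfold expInv
  have : w ^ k ≠ 0 := pow_ne_zero _ h0
  refine DifferentiableAt.differentiableWithinAt ?_
  fun_prop (disch := assumption)

lemma ofReal_tsum_moment {b : ℕ → ℝ} (hb : PolyBounded b) (i : ℕ) {Y : ℝ} (hY : 0 < Y) :
    ((∑' n : ℕ, b n * (2 * Real.pi * n * Y) ^ i * Real.exp (-(2 * Real.pi * n * Y)) : ℝ) : ℂ) =
      (-(Y : ℂ)) ^ i * iteratedDeriv i (expSeries b) (Y : ℂ) := by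
  rw [iteratedDeriv_expSeries hb i (by simpa using hY), expSeries, ← tsum_mul_left,
    Complex.ofReal_tsum]
  refine tsum_congr fun n => ?_
  push_cast
  have : (2 * (Real.pi : ℂ) * n * Y) ^ i = (-(Y : ℂ)) ^ i * (-(2 * Real.pi * n)) ^ i := by
    rw [← _root_.mul_pow]; ring
  rw [this]; ring

lemma inv_re_pos {w : ℂ} (hw : 0 < w.re) : 0 < w⁻¹.re := by
  have h0 : w ≠ 0 := by rintro rfl; simp at hw
  rw [Complex.inv_re]
  exact div_pos hw (Complex.normSq_pos.2 h0)

/-- The moments `∑ b n s^i e^{-s}`, `s = 2πnY`, of a Fourier series satisfying a modular relation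
are governed as `Y → 0` by its first nonvanishing coefficient. -/
theorem exists_moment_approx {k : ℕ} {b : ℕ → ℝ} (hb : PolyBounded b) {m : ℕ}
    (h0 : ∀ n < m, b n = 0) {ε : ℝ} (hε : ε ^ 2 = 1)
    (hmod : ∀ w : ℂ, 0 < w.re → expSeries b w⁻¹ = ε * w ^ k * expSeries b w) :
    ∃ D : ℝ, 0 ≤ D ∧ ∀ Y : ℝ, 0 < Y → Y ≤ 1 / 2 → ∀ J : ℕ, 1 ≤ J → ∀ i ≤ J,
      |(∑' n : ℕ, b n * (2 * Real.pi * n * Y) ^ i * Real.exp (-(2 * Real.pi * n * Y))) -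
        ε * b m * ((Y ^ k)⁻¹ * Real.exp (-(2 * Real.pi * m / Y)) *
          (lagPoly k i).eval (2 * Real.pi * m / Y))| ≤
        i.factorial * (D * (2 * J / Y) ^ k * Real.exp (-(Real.pi * (m + 1) / Y))) ∧
      |ε * b m * ((Y ^ k)⁻¹ * Real.exp (-(2 * Real.pi * m / Y)) *
          (lagPoly k i).eval (2 * Real.pi * m / Y))| ≤
        i.factorial * (D * (2 * J / Y) ^ k * Real.exp (-(Real.pi * m / Y))) := by
  have hb' := hb.update m
  have hb0 : ∀ n < m + 1, Function.update b m 0 n = 0 := by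
    intro n hn
    by_cases h : n = m
    · simp [h]
    · simpa [h] using h0 n (by omega)
  obtain ⟨D, hD, hDb⟩ := norm_expSeries_le hb' hb0
  have hεn : ‖(ε : ℂ)‖ = 1 := by
    rw [Complex.norm_real, Real.norm_eq_abs]
    exact (pow_eq_one_iff_of_nonneg (abs_nonneg ε) two_ne_zero).1 (by rw [sq_abs, hε])
  have hε2 : (ε : ℂ) * ε = 1 := by rw [← sq]; exact_mod_cast hε
  set M : ℂ → ℂ := fun w => ((ε * b m : ℝ) : ℂ) * expInv k (2 * Real.pi * m) w with hM
  set R : ℂ → ℂ := fun w => expSeries b w - M w with hR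
  have hMd : DifferentiableOn ℂ M {w : ℂ | 0 < w.re} :=
    (differentiableOn_expInv k _).const_mul _
  have hGd := differentiableOn_expSeries hb
  have hRd : DifferentiableOn ℂ R {w : ℂ | 0 < w.re} := hGd.sub hMd
  have hne : ∀ w : ℂ, 0 < w.re → w ≠ 0 := by
    rintro w hw rfl
    simp at hw
  have hRb : ∀ w : ℂ, 0 < w.re → 1 ≤ (w⁻¹).re → ‖R w‖ ≤ (D + |b m|) * (‖w‖ ^ k)⁻¹ *
      Real.exp (-(2 * Real.pi * ((m + 1 : ℕ) : ℝ) * (w⁻¹).re)) := by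
    intro w hw hw1
    have hw0 := hne w hw
    have e1 := hmod w hw
    rw [expSeries_eq_add_update hb m (inv_re_pos hw)] at e1
    have e2 : R w = ε * (w ^ k)⁻¹ * expSeries (Function.update b m 0) w⁻¹ := by
      have e3 : expSeries b w = ε * (w ^ k)⁻¹ * (ε * w ^ k * expSeries b w) := by
        have : w ^ k ≠ 0 := pow_ne_zero _ hw0
        field_simp
        linear_combination -(expSeries b w) * hε2
      rw [hR, hM]
      simp only
      rw [e3, ← e1, expInv]
      push_cast
      rw [div_eq_mul_inv]
      ring
    rw [e2, norm_mul, norm_mul, hεn, one_mul, norm_inv, norm_pow]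
    have h := hDb _ hw1
    have : 0 ≤ (‖w‖ ^ k)⁻¹ := by positivity
    calc _ ≤ (‖w‖ ^ k)⁻¹ * (D * Real.exp (-(2 * Real.pi * ((m + 1 : ℕ) : ℝ) * (w⁻¹).re))) := by
          gcongr
      _ = D * (‖w‖ ^ k)⁻¹ * Real.exp (-(2 * Real.pi * ((m + 1 : ℕ) : ℝ) * (w⁻¹).re)) := by ring
      _ ≤ _ := by gcongr; linarith [abs_nonneg (b m)]
  have hMb : ∀ w : ℂ, 0 < w.re → 1 ≤ (w⁻¹).re → ‖M w‖ ≤ (D + |b m|) * (‖w‖ ^ k)⁻¹ *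
      Real.exp (-(2 * Real.pi * m * (w⁻¹).re)) := by
    intro w hw _
    have e : ‖Complex.exp (-(((2 * Real.pi * m : ℝ) : ℂ) / w))‖ =
        Real.exp (-(2 * Real.pi * m * (w⁻¹).re)) := by
      rw [Complex.norm_exp, div_eq_mul_inv, Complex.neg_re, Complex.re_ofReal_mul]
    rw [hM]
    simp only
    rw [expInv, norm_mul, norm_mul, e, norm_inv, norm_pow, Complex.ofReal_mul, norm_mul, hεn,
      one_mul, Complex.norm_real, Real.norm_eq_abs, ← mul_assoc]
    gcongr
    linarith
  refine ⟨2 * (D + |b m|), by positivity, fun Y hY hY2 J hJ i hi => ?_⟩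
  have hYmem : {w : ℂ | 0 < w.re} ∈ nhds (Y : ℂ) :=
    (isOpen_lt continuous_const continuous_re).mem_nhds (by simpa using hY)
  have hMY : ((ε * b m * ((Y ^ k)⁻¹ * Real.exp (-(2 * Real.pi * m / Y)) *
      (lagPoly k i).eval (2 * Real.pi * m / Y)) : ℝ) : ℂ) =
      (-(Y : ℂ)) ^ i * iteratedDeriv i M (Y : ℂ) := by
    rw [hM, iteratedDeriv_const_mul_field, Complex.ofReal_mul,
      ← iteratedDeriv_expInv_ofReal k _ i hY.ne']
    ring
  have hRY : (((∑' n : ℕ, b n * (2 * Real.pi * n * Y) ^ i * Real.exp (-(2 * Real.pi * n * Y))) -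
      ε * b m * ((Y ^ k)⁻¹ * Real.exp (-(2 * Real.pi * m / Y)) *
      (lagPoly k i).eval (2 * Real.pi * m / Y)) : ℝ) : ℂ) =
      (-(Y : ℂ)) ^ i * iteratedDeriv i R (Y : ℂ) := by
    rw [Complex.ofReal_sub, hMY, ofReal_tsum_moment hb i hY, hR, iteratedDeriv_fun_sub
      (hGd.analyticAt hYmem).contDiffAt (hMd.analyticAt hYmem).contDiffAt]
    ring
  have hn : ∀ g : ℂ → ℂ, ‖(-(Y : ℂ)) ^ i * iteratedDeriv i g (Y : ℂ)‖ =
      Y ^ i * ‖iteratedDeriv i g (Y : ℂ)‖ := fun g => by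
    rw [norm_mul, norm_pow, norm_neg, Complex.norm_real, Real.norm_of_nonneg hY.le]
  have hDm : 0 ≤ D + |b m| := by positivity
  constructor
  · rw [← Real.norm_eq_abs, ← Complex.norm_real, hRY, hn]
    simpa using norm_iteratedDeriv_le_of_horocycle hRd hDm hRb hY hY2 hJ hi
  · rw [← Real.norm_eq_abs, ← Complex.norm_real, hMY, hn]
    exact norm_iteratedDeriv_le_of_horocycle hMd hDm hMb hY hY2 hJ hi

lemma one_le_one_sub_mul_exp {η : ℝ} (h2 : η ≤ 1 / 4) :
    1 ≤ (1 - η) * Real.exp (η + η ^ 2) := by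
  rcases le_total 0 η with h | h
  · have := Real.quadratic_le_exp_of_nonneg (x := η + η ^ 2) (by positivity)
    nlinarith [mul_le_mul_of_nonneg_left this (by linarith : (0 : ℝ) ≤ 1 - η), sq_nonneg η,
      mul_nonneg h (sq_nonneg η), mul_nonneg (sq_nonneg η) (by linarith : (0 : ℝ) ≤ 1 / 4 - η),
      mul_nonneg (mul_nonneg h (sq_nonneg η)) (by linarith : (0 : ℝ) ≤ 1 / 4 - η),
      mul_nonneg (sq_nonneg (η ^ 2)) (by linarith : (0 : ℝ) ≤ 1 / 4 - η)]
  · have := Real.add_one_le_exp (η + η ^ 2)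
    nlinarith [mul_le_mul_of_nonneg_left this (by linarith : (0 : ℝ) ≤ 1 - η),
      mul_nonneg (neg_nonneg.2 h) (sq_nonneg η)]

lemma pow_mul_exp_neg_le {s : ℝ} (hs : 0 ≤ s) (j : ℕ) {η : ℝ} (h2 : η ≤ 1 / 4) :
    s ^ j * Real.exp (-s) ≤ j.factorial * Real.exp (j * η ^ 2 - η * (s - j)) := by
  have hη : 0 < 1 - η := by linarith
  have a := Real.pow_div_factorial_le_exp ((1 - η) * s) (by positivity) j
  rw [div_le_iff₀ (by positivity), _root_.mul_pow] at a
  have b := one_le_pow₀ (one_le_one_sub_mul_exp h2) (n := j)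
  rw [_root_.mul_pow, ← Real.exp_nat_mul] at b
  have e : Real.exp (j * η ^ 2 - η * (s - j)) =
      Real.exp (-s) * (Real.exp (j * (η + η ^ 2)) * Real.exp ((1 - η) * s)) := by
    rw [← Real.exp_add, ← Real.exp_add]; congr 1; ring
  have : s ^ j ≤ j.factorial * (Real.exp (j * (η + η ^ 2)) * Real.exp ((1 - η) * s)) := by
    calc s ^ j = s ^ j * 1 := by ring
      _ ≤ s ^ j * ((1 - η) ^ j * Real.exp (j * (η + η ^ 2))) := by gcongr
      _ = ((1 - η) ^ j * s ^ j) * Real.exp (j * (η + η ^ 2)) := by ring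
      _ ≤ (Real.exp ((1 - η) * s) * j.factorial) * Real.exp (j * (η + η ^ 2)) := by gcongr
      _ = _ := by ring
  rw [e]
  calc _ ≤ j.factorial * (Real.exp (j * (η + η ^ 2)) * Real.exp ((1 - η) * s)) * Real.exp (-s) := by
        gcongr
    _ = _ := by ring

/-- The Gamma density of order `j ≤ 8q¹⁹` is tiny at distance `q¹¹` from its peak. -/
lemma pow_mul_exp_neg_le_of_far {s q : ℝ} (hs : 0 ≤ s) (hq : 1 ≤ q) {j : ℕ}
    (hj : (j : ℝ) ≤ 8 * q ^ 19) (hd : q ^ 11 ≤ |s - j|) :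
    s ^ j * Real.exp (-s) ≤ j.factorial * Real.exp (-(q ^ 3 / 32)) := by
  have hq0 : 0 < q := by linarith
  set t : ℝ := (q ^ 8)⁻¹ / 16 with ht
  have ht0 : 0 < t := by positivity
  have ht1 : t ≤ 1 / 4 := by
    have : (q ^ 8)⁻¹ ≤ 1 := inv_le_one_of_one_le₀ (one_le_pow₀ hq)
    rw [ht]; linarith
  have hj2 : j * t ^ 2 ≤ q ^ 3 / 32 := by
    calc j * t ^ 2 ≤ 8 * q ^ 19 * t ^ 2 := by gcongr
      _ = q ^ 3 / 32 := by rw [ht]; field_simp; norm_num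
  have hd2 : q ^ 3 / 16 ≤ t * |s - j| := by
    calc q ^ 3 / 16 = t * q ^ 11 := by rw [ht]; field_simp
      _ ≤ _ := by gcongr
  rcases le_total 0 (s - j) with h | h
  · refine (pow_mul_exp_neg_le hs j (η := t) ht1).trans ?_
    rw [abs_of_nonneg h] at hd2
    gcongr
    linarith
  · refine (pow_mul_exp_neg_le hs j (η := -t) (by linarith)).trans ?_
    rw [abs_of_nonpos h] at hd2
    gcongr
    linarith [neg_sq t]

/-- Integers in the interval `(q²⁰, q²⁰ + q¹²]`. -/
noncomputable def windowFinset (q : ℝ) : Finset ℕ :=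
  Finset.Ioc ⌊q ^ 20⌋₊ ⌊q ^ 20 + q ^ 12⌋₊

lemma mem_windowFinset {q : ℝ} {n : ℕ} :
    n ∈ windowFinset q ↔ q ^ 20 < n ∧ (n : ℝ) ≤ q ^ 20 + q ^ 12 := by
  rw [windowFinset, Finset.mem_Ioc, Nat.floor_lt (by positivity), Nat.le_floor_iff (by positivity)]

lemma le_abs_sub_of_notMem_windowFinset {q : ℝ} {K j l n : ℕ} (hq : (K : ℝ) + 5 ≤ q)
    (hj1 : 2 * Real.pi * q ^ 19 + 2 * q ^ 11 ≤ j)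
    (hj2 : j ≤ 2 * Real.pi * q ^ 19 + 2 * q ^ 11 + 1) (hl : j ≤ l) (hl2 : l ≤ j + K + 4)
    (hn : n ∉ windowFinset q) :
    q ^ 11 ≤ |2 * Real.pi * n * q⁻¹ - l| := by
  have hK : (0 : ℝ) ≤ K := Nat.cast_nonneg K
  have hq0 : 0 < q := by linarith
  have hq1 : 1 ≤ q := by linarith
  have hl' : (j : ℝ) ≤ l := by exact_mod_cast hl
  have hl2' : (l : ℝ) ≤ j + K + 4 := by exact_mod_cast hl2
  have h11 : q ≤ q ^ 11 := le_self_pow₀ hq1 (by norm_num)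
  have hpi := Real.pi_gt_three
  rw [mem_windowFinset, not_and_or, not_lt, not_le] at hn
  rcases hn with hn | hn
  · have : 2 * Real.pi * n * q⁻¹ ≤ 2 * Real.pi * q ^ 20 * q⁻¹ := by gcongr
    have e : 2 * Real.pi * q ^ 20 * q⁻¹ = 2 * Real.pi * q ^ 19 := by field_simp
    rw [abs_sub_comm]
    exact le_trans (by nlinarith) (le_abs_self _)
  · have : 2 * Real.pi * (q ^ 20 + q ^ 12) * q⁻¹ ≤ 2 * Real.pi * n * q⁻¹ := by gcongr
    have e : 2 * Real.pi * (q ^ 20 + q ^ 12) * q⁻¹ =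
        2 * Real.pi * q ^ 19 + 2 * Real.pi * q ^ 11 := by
      field_simp
    refine le_trans ?_ (le_abs_self _)
    nlinarith

lemma add_le_eight_mul_pow {q : ℝ} {K j : ℕ} (hq : (K : ℝ) + 5 ≤ q)
    (hj2 : j ≤ 2 * Real.pi * q ^ 19 + 2 * q ^ 11 + 1) : (j : ℝ) + K + 4 ≤ 8 * q ^ 19 := by
  have hK : (0 : ℝ) ≤ K := Nat.cast_nonneg K
  have hq1 : 1 ≤ q := by linarith
  have h11 : q ≤ q ^ 11 := le_self_pow₀ hq1 (by norm_num)
  have h8 : (5 : ℝ) ^ 8 ≤ q ^ 8 := by gcongr; linarith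
  have hpi := Real.pi_lt_d2
  have e : q ^ 19 = q ^ 8 * q ^ 11 := by ring
  have h19 : (5 : ℝ) ^ 8 * q ^ 11 ≤ q ^ 19 := by rw [e]; gcongr
  have h0 : 0 ≤ q ^ 11 := by positivity
  nlinarith

lemma factorial_add_le_mul_pow (j n : ℕ) :
    (j + n).factorial ≤ j.factorial * (j + n) ^ n := by
  rw [← Nat.factorial_mul_ascFactorial]
  exact Nat.mul_le_mul_left _ (Nat.ascFactorial_le_pow_add j n)

lemma PolyBounded.abs_tail_le {b : ℕ → ℝ} {C : ℝ} {K : ℕ} (hC : ∀ n, |b n| ≤ C * (n : ℝ) ^ K)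
    (hb0 : b 0 = 0) {q : ℝ} {j i : ℕ} (hq : (K : ℝ) + 5 ≤ q)
    (hj1 : 2 * Real.pi * q ^ 19 + 2 * q ^ 11 ≤ j)
    (hj2 : j ≤ 2 * Real.pi * q ^ 19 + 2 * q ^ 11 + 1) (hi : i ≤ 2) :
    |(∑' n : ℕ, b n * (2 * Real.pi * n * q⁻¹) ^ (j + i) * Real.exp (-(2 * Real.pi * n * q⁻¹))) -
      ∑ n ∈ windowFinset q,
        b n * (2 * Real.pi * n * q⁻¹) ^ (j + i) * Real.exp (-(2 * Real.pi * n * q⁻¹))| ≤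
      j.factorial * (C * (∑' n : ℕ, 1 / (n : ℝ) ^ 2) * q ^ (K + 2) * (8 * q ^ 19) ^ (K + 4) *
        Real.exp (-(q ^ 3 / 32))) := by
  have hK : (0 : ℝ) ≤ K := Nat.cast_nonneg K
  have hq0 : 0 < q := by linarith
  have hC0 : 0 ≤ C := by simpa using (abs_nonneg _).trans (hC 1)
  set F : ℕ → ℝ := fun n =>
    b n * (2 * Real.pi * n * q⁻¹) ^ (j + i) * Real.exp (-(2 * Real.pi * n * q⁻¹)) with hF
  have hFs : Summable F := by
    have hb : PolyBounded b := ⟨C, K, hC⟩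
    refine Summable.of_norm_bounded
      (g := fun n => |(fun n => b n * (-(2 * Real.pi * n)) ^ (j + i)) n| *
      Real.exp (-(2 * Real.pi * n * q⁻¹)) * q⁻¹ ^ (j + i))
      (((hb.mul_pow (j + i)).summable (inv_pos.2 hq0)).mul_right _) fun n => le_of_eq ?_
    simp only [hF, Real.norm_eq_abs, abs_mul, abs_pow, abs_neg, Real.abs_exp,
      abs_of_nonneg (inv_pos.2 hq0).le, _root_.mul_pow]
    ring
  have hsplit : (∑' n, F n) - ∑ n ∈ windowFinset q, F n =
      ∑' n, if n ∈ windowFinset q then 0 else F n := by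
    have h1 : ∑ n ∈ windowFinset q, F n = ∑' n, if n ∈ windowFinset q then F n else 0 := by
      rw [tsum_eq_sum (s := windowFinset q) (fun n hn => if_neg hn)]
      exact Finset.sum_congr rfl fun n hn => (if_pos hn).symm
    have h2 : Summable fun n => if n ∈ windowFinset q then F n else 0 :=
      summable_of_ne_finset_zero (s := windowFinset q) fun n hn => if_neg hn
    rw [h1, ← hFs.tsum_sub h2]
    refine tsum_congr fun n => ?_
    split_ifs <;> simp
  have hl8 := add_le_eight_mul_pow hq hj2
  have hfac : ((j + i + (K + 2)).factorial : ℝ) ≤ j.factorial * (8 * q ^ 19) ^ (K + 4) := by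
    have h1 : (j + i + (K + 2)).factorial ≤ j.factorial * (j + (K + 4)) ^ (K + 4) :=
      (Nat.factorial_le (by omega : j + i + (K + 2) ≤ j + (K + 4))).trans
        (factorial_add_le_mul_pow _ _)
    have h2 : ((j + i + (K + 2)).factorial : ℝ) ≤ j.factorial * ((j : ℝ) + (K + 4)) ^ (K + 4) := by
      exact_mod_cast h1
    refine h2.trans ?_
    gcongr
    linarith
  rw [hsplit, ← Real.norm_eq_abs]
  have hsum : HasSum (fun n : ℕ => (j.factorial * (C * q ^ (K + 2) * (8 * q ^ 19) ^ (K + 4) *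
        Real.exp (-(q ^ 3 / 32)))) * (1 / (n : ℝ) ^ 2)) _ :=
    (Real.summable_one_div_nat_pow.2 one_lt_two).hasSum.mul_left _
  refine (tsum_of_norm_bounded hsum fun n => ?_).trans (le_of_eq (by ring))
  split_ifs with hn
  · rw [norm_zero]; positivity
  rcases Nat.eq_zero_or_pos n with rfl | hn0
  · simp [hF, hb0]
  have hn0' : (0 : ℝ) < n := by exact_mod_cast hn0
  set s : ℝ := 2 * Real.pi * n * q⁻¹ with hs
  have hs0 : 0 ≤ s := by positivity
  have hfar := pow_mul_exp_neg_le_of_far hs0 (by linarith) (j := j + i + (K + 2)) (q := q)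
    (by
      have : (i : ℝ) ≤ 2 := by exact_mod_cast hi
      push_cast; linarith)
    (le_abs_sub_of_notMem_windowFinset hq hj1 hj2 (by omega) (by omega) hn)
  have hns : (n : ℝ) ^ (K + 2) ≤ q ^ (K + 2) * s ^ (K + 2) := by
    rw [← _root_.mul_pow]
    gcongr
    rw [hs]
    have : q * (2 * Real.pi * n * q⁻¹) = 2 * Real.pi * n := by field_simp
    rw [this]
    nlinarith [Real.pi_gt_three]
  have hFn : ‖F n‖ = |b n| * s ^ (j + i) * Real.exp (-s) := by
    rw [hF, Real.norm_eq_abs]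
    simp only
    rw [abs_mul, abs_mul, Real.abs_exp, abs_of_nonneg (by positivity : 0 ≤ s ^ (j + i))]
  rw [hFn, mul_one_div, le_div_iff₀ (by positivity)]
  calc |b n| * s ^ (j + i) * Real.exp (-s) * (n : ℝ) ^ 2
      ≤ C * (n : ℝ) ^ K * s ^ (j + i) * Real.exp (-s) * (n : ℝ) ^ 2 := by gcongr; exact hC n
    _ = C * (s ^ (j + i) * Real.exp (-s)) * (n : ℝ) ^ (K + 2) := by ring
    _ ≤ C * (s ^ (j + i) * Real.exp (-s)) * (q ^ (K + 2) * s ^ (K + 2)) := by gcongr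
    _ = C * q ^ (K + 2) * (s ^ (j + i + (K + 2)) * Real.exp (-s)) := by ring
    _ ≤ C * q ^ (K + 2) * (((j + i + (K + 2)).factorial : ℝ) * Real.exp (-(q ^ 3 / 32))) := by
        gcongr
    _ ≤ C * q ^ (K + 2) * (j.factorial * (8 * q ^ 19) ^ (K + 4) * Real.exp (-(q ^ 3 / 32))) := by
        gcongr
    _ = _ := by ring

/-- The main term of the `i`-th moment at `Y = 1/q`. -/
noncomputable def mainTerm (k m : ℕ) (c q : ℝ) (i : ℕ) : ℝ :=
  c * (q ^ k * Real.exp (-(2 * Real.pi * m * q)) * (lagPoly k i).eval (2 * Real.pi * m * q))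

theorem exists_window_moment_approx {k : ℕ} {b : ℕ → ℝ} (hb : PolyBounded b) (hb0 : b 0 = 0)
    {m : ℕ} (h0 : ∀ n < m, b n = 0) {ε : ℝ} (hε : ε ^ 2 = 1)
    (hmod : ∀ w : ℂ, 0 < w.re → expSeries b w⁻¹ = ε * w ^ k * expSeries b w) :
    ∃ A : ℝ, 0 ≤ A ∧ ∃ N : ℕ, ∃ q₁ : ℝ, 5 ≤ q₁ ∧ ∀ q : ℝ, q₁ ≤ q → ∀ j : ℕ,
      2 * Real.pi * q ^ 19 + 2 * q ^ 11 ≤ j → j ≤ 2 * Real.pi * q ^ 19 + 2 * q ^ 11 + 1 →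
      ∀ i ≤ 2,
      |(∑ n ∈ windowFinset q,
          b n * (2 * Real.pi * n * q⁻¹) ^ (j + i) * Real.exp (-(2 * Real.pi * n * q⁻¹))) -
        mainTerm k m (ε * b m) q (j + i)| ≤
        j.factorial * (A * q ^ N * Real.exp (-(Real.pi * (m + 1) * q))) ∧
      |mainTerm k m (ε * b m) q (j + i)| ≤
        j.factorial * (A * q ^ N * Real.exp (-(Real.pi * m * q))) := by
  obtain ⟨D, hD, hap⟩ := exists_moment_approx hb h0 hε hmod
  obtain ⟨C, K, hC⟩ := id hb
  have hC0 : 0 ≤ C := by simpa using (abs_nonneg _).trans (hC 1)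
  have hS : 0 ≤ ∑' n : ℕ, 1 / (n : ℝ) ^ 2 := tsum_nonneg fun n => by positivity
  set S : ℝ := ∑' n : ℕ, 1 / (n : ℝ) ^ 2
  set A₁ : ℝ := 64 * D * 16 ^ k with hA₁
  set A₂ : ℝ := C * S * 8 ^ (K + 4) with hA₂
  set N₁ : ℕ := 38 + 20 * k with hN₁
  set N₂ : ℕ := K + 2 + 19 * (K + 4) with hN₂
  refine ⟨A₁ + A₂, by positivity, N₁ + N₂, max (K + 5) (32 * Real.pi * (m + 1)),
    (by simp : (5 : ℝ) ≤ K + 5).trans (le_max_left _ _), fun q hq j hj1 hj2 i hi => ?_⟩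
  have hqK : (K : ℝ) + 5 ≤ q := (le_max_left _ _).trans hq
  have hqm : 32 * Real.pi * (m + 1) ≤ q := (le_max_right _ _).trans hq
  have hK : (0 : ℝ) ≤ K := Nat.cast_nonneg K
  have hq1 : 1 ≤ q := by linarith
  have hq0 : 0 < q := by linarith
  have hl8 := add_le_eight_mul_pow hqK hj2
  have hj8 : (j : ℝ) + 2 ≤ 8 * q ^ 19 := by linarith
  have hfac : ((j + i).factorial : ℝ) ≤ j.factorial * (8 * q ^ 19) ^ 2 := by
    have h1 : (j + i).factorial ≤ j.factorial * (j + 2) ^ 2 :=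
      (Nat.factorial_le (by omega)).trans (factorial_add_le_mul_pow j 2)
    have h2 : ((j + i).factorial : ℝ) ≤ j.factorial * ((j : ℝ) + 2) ^ 2 := by exact_mod_cast h1
    refine h2.trans ?_
    gcongr
  have hpowN₁ : q ^ N₁ ≤ q ^ (N₁ + N₂) := pow_le_pow_right₀ hq1 (by omega)
  have hpowN₂ : q ^ N₂ ≤ q ^ (N₁ + N₂) := pow_le_pow_right₀ hq1 (by omega)
  have hA₁0 : 0 ≤ A₁ := by positivity
  have hA₂0 : 0 ≤ A₂ := by positivity
  have hmain : ∀ E : ℝ, 0 ≤ E → ((j + i).factorial : ℝ) *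
      (D * (2 * ((j + 2 : ℕ) : ℝ) * q) ^ k * E) ≤ j.factorial * (A₁ * q ^ N₁ * E) := by
    intro E hE
    have h3 : 2 * ((j + 2 : ℕ) : ℝ) * q ≤ 16 * q ^ 20 := by
      push_cast
      calc 2 * ((j : ℝ) + 2) * q ≤ 2 * (8 * q ^ 19) * q := by gcongr
        _ = _ := by ring
    calc _ ≤ (j.factorial * (8 * q ^ 19) ^ 2) * (D * (16 * q ^ 20) ^ k * E) := by gcongr
      _ = _ := by
        rw [hA₁, hN₁, _root_.mul_pow, pow_add, pow_mul]
        ring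
  have h1 := hap q⁻¹ (inv_pos.2 hq0) (by
    rw [one_div]; exact inv_anti₀ two_pos (by linarith)) (j + 2) (by omega) (j + i) (by omega)
  simp only [div_inv_eq_mul, inv_pow, inv_inv] at h1
  have h2 := PolyBounded.abs_tail_le hC hb0 hqK hj1 hj2 hi
  obtain ⟨h1a, h1b⟩ := h1
  have hexp : Real.exp (-(q ^ 3 / 32)) ≤ Real.exp (-(Real.pi * (m + 1) * q)) := by
    apply Real.exp_le_exp.2
    have : 32 * Real.pi * (m + 1) * q ≤ q ^ 2 * q := by
      gcongr
      nlinarith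
    nlinarith
  have h2' : j.factorial * (C * S * q ^ (K + 2) * (8 * q ^ 19) ^ (K + 4) *
      Real.exp (-(q ^ 3 / 32))) ≤
      j.factorial * (A₂ * q ^ N₂ * Real.exp (-(Real.pi * (m + 1) * q))) := by
    calc _ ≤ j.factorial * (C * S * q ^ (K + 2) * (8 * q ^ 19) ^ (K + 4) *
          Real.exp (-(Real.pi * (m + 1) * q))) := by gcongr
      _ = _ := by
        rw [hA₂, hN₂, _root_.mul_pow, pow_add q (K + 2), pow_mul q 19]
        ring
  constructor
  · rw [abs_sub_comm] at h2
    refine (abs_sub_le _ _ _).trans ((add_le_add (h2.trans h2')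
      (h1a.trans (hmain _ (Real.exp_pos _).le))).trans ?_)
    rw [← mul_add, ← add_mul]
    gcongr
    calc A₂ * q ^ N₂ + A₁ * q ^ N₁ ≤ A₂ * q ^ (N₁ + N₂) + A₁ * q ^ (N₁ + N₂) := by gcongr
      _ = _ := by ring
  · refine (h1b.trans (hmain _ (Real.exp_pos _).le)).trans ?_
    gcongr
    linarith

/-- If all `b n ≥ 0` on a finite set, consecutive moments satisfy the Cauchy–Schwarz inequality. -/
lemma moment_sq_le_mul (W : Finset ℕ) {b s e : ℕ → ℝ} (hb : ∀ n ∈ W, 0 ≤ b n)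
    (hs : ∀ n, 0 ≤ s n) (he : ∀ n, 0 ≤ e n) (j : ℕ) :
    (∑ n ∈ W, b n * s n ^ (j + 1) * e n) ^ 2 ≤
      (∑ n ∈ W, b n * s n ^ (j + 0) * e n) * ∑ n ∈ W, b n * s n ^ (j + 2) * e n := by
  refine Finset.sum_sq_le_sum_mul_sum_of_sq_le_mul W (fun n hn => ?_) (fun n hn => ?_)
    (fun n _ => le_of_eq (by ring))
  · exact mul_nonneg (mul_nonneg (hb n hn) (pow_nonneg (hs n) _)) (he n)
  · exact mul_nonneg (mul_nonneg (hb n hn) (pow_nonneg (hs n) _)) (he n)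

lemma sq_sub_mul_le_of_approx {M₀ M₁ M₂ N₀ N₁ N₂ B δ : ℝ} (hN : N₁ ^ 2 ≤ N₀ * N₂)
    (h0 : |N₀ - M₀| ≤ δ) (h1 : |N₁ - M₁| ≤ δ) (h2 : |N₂ - M₂| ≤ δ)
    (hM0 : |M₀| ≤ B) (hM1 : |M₁| ≤ B) (hM2 : |M₂| ≤ B) :
    M₁ ^ 2 - M₀ * M₂ ≤ 4 * (B * δ) + δ ^ 2 := by
  have key : ∀ {x y X Y : ℝ}, |x| ≤ X → |y| ≤ Y → |x * y| ≤ X * Y := fun hx hy => by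
    rw [abs_mul]
    exact mul_le_mul hx hy (abs_nonneg _) ((abs_nonneg _).trans hx)
  have a := (abs_le.1 (key hM1 h1)).1
  have b := (abs_le.1 (key hM0 h2)).2
  have c := (abs_le.1 (key hM2 h0)).2
  have d := (abs_le.1 (key h0 h2)).2
  nlinarith [sq_nonneg (N₁ - M₁)]

set_option maxHeartbeats 1000000 in
/-- A Fourier series with a modular relation under `w ↦ w⁻¹` has a negative coefficient in every
window `(q²⁰, q²⁰ + q¹²]` with `q` large. -/
theorem exists_neg_of_expSeries_modular {k : ℕ} (hk : 2 ≤ k) {b : ℕ → ℝ} (hb : PolyBounded b)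
    (hb0 : b 0 = 0) {m : ℕ} (h0 : ∀ n < m, b n = 0) (hm : b m ≠ 0) {ε : ℝ} (hε : ε ^ 2 = 1)
    (hmod : ∀ w : ℂ, 0 < w.re → expSeries b w⁻¹ = ε * w ^ k * expSeries b w) :
    ∃ q₀ : ℝ, 0 < q₀ ∧ ∀ q : ℝ, q₀ ≤ q → ∃ n ∈ windowFinset q, b n < 0 := by
  have hm1 : 1 ≤ m := Nat.one_le_iff_ne_zero.2 fun h => hm (h ▸ hb0)
  have hm1' : (1 : ℝ) ≤ m := by exact_mod_cast hm1
  obtain ⟨A, hA, N, q₁, hq₁, hap⟩ := exists_window_moment_approx hb hb0 h0 hε hmod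
  set L : ℝ := 500 * (2 * Real.pi * m) ^ (2 * k) * 16 ^ (2 * k) * A ^ 2 with hL
  have hlim : Tendsto (fun q : ℝ => L * (q ^ (38 * k + 2 * N) * Real.exp (-q))) atTop (nhds 0) := by
    simpa using (Real.tendsto_pow_mul_exp_neg_atTop_nhds_zero (38 * k + 2 * N)).const_mul L
  have hbm : 0 < b m ^ 2 := by positivity
  obtain ⟨q₂, hq₂⟩ := eventually_atTop.1 (hlim.eventually (gt_mem_nhds hbm))
  refine ⟨max (max q₁ q₂) (max m ((k : ℝ) ^ 2)), by
    have := (le_max_left q₁ q₂).trans (le_max_left _ (max (m : ℝ) ((k : ℝ) ^ 2)))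
    linarith, fun q hq => ?_⟩
  have hqq₁ : q₁ ≤ q := ((le_max_left _ _).trans (le_max_left _ _)).trans hq
  have hqq₂ : q₂ ≤ q := ((le_max_right _ _).trans (le_max_left _ _)).trans hq
  have hqm : (m : ℝ) ≤ q := ((le_max_left _ _).trans (le_max_right _ _)).trans hq
  have hqk : (k : ℝ) ^ 2 ≤ q := ((le_max_right _ _).trans (le_max_right _ _)).trans hq
  have hq5 : 5 ≤ q := hq₁.trans hqq₁
  have hq0 : 0 < q := by linarith
  have hpi := Real.pi_gt_three
  by_contra! hcon
  set j : ℕ := ⌈2 * Real.pi * q ^ 19 + 2 * q ^ 11⌉₊ with hj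
  have hj1 : 2 * Real.pi * q ^ 19 + 2 * q ^ 11 ≤ j := Nat.le_ceil _
  have hj2 : j ≤ 2 * Real.pi * q ^ 19 + 2 * q ^ 11 + 1 := (Nat.ceil_lt_add_one (by positivity)).le
  have hj8 : (j : ℝ) + 4 ≤ 8 * q ^ 19 := by
    simpa using add_le_eight_mul_pow (K := 0) (by simpa using hq5) hj2
  have happ := hap q hqq₁ j hj1 hj2
  have hCS := moment_sq_le_mul (windowFinset q) hcon (s := fun n => 2 * Real.pi * n * q⁻¹)
    (e := fun n => Real.exp (-(2 * Real.pi * n * q⁻¹))) (fun n => by positivity)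
    (fun n => (Real.exp_pos _).le) j
  have hup := sq_sub_mul_le_of_approx hCS (happ 0 (by norm_num)).1 (happ 1 (by norm_num)).1
    (happ 2 le_rfl).1 (happ 0 (by norm_num)).2 (happ 1 (by norm_num)).2 (happ 2 le_rfl).2
  set x : ℝ := 2 * Real.pi * m * q with hx
  set v : ℝ := Real.exp (-(Real.pi * m * q)) with hv
  set u : ℝ := Real.exp (-(Real.pi * q)) with hu
  have hv0 : 0 < v := Real.exp_pos _
  have hu0 : 0 < u := Real.exp_pos _
  have hu1 : u ≤ 1 := Real.exp_le_one_iff.2 (by simp only [Left.neg_nonpos_iff]; positivity)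
  have huv : Real.exp (-(Real.pi * (m + 1) * q)) = u * v := by
    rw [hu, hv, ← Real.exp_add]; congr 1; ring
  have hvx : Real.exp (-x) = v ^ 2 := by
    rw [hv, hx, ← Real.exp_nat_mul]; congr 1; push_cast; ring
  have hvx' : v ^ 2 * Real.exp x = 1 := by rw [← hvx, ← Real.exp_add]; simp
  have hj19 : q ^ 19 ≤ j := by
    refine le_trans ?_ hj1
    have : 0 ≤ q ^ 19 := by positivity
    have : 0 ≤ q ^ 11 := by positivity
    nlinarith
  have hxj : x ≤ j := by
    refine le_trans ?_ hj1
    have h18 : q ≤ q ^ 18 := le_self_pow₀ (by linarith) (by norm_num)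
    calc x ≤ 2 * Real.pi * q ^ 18 * q := by rw [hx]; gcongr; linarith
      _ = 2 * Real.pi * q ^ 19 := by ring
      _ ≤ _ := by have : 0 ≤ q ^ 11 := by positivity
                  linarith
  have hx4 : 4 ≤ x := by
    have : 2 * 3 * 1 * 5 ≤ x := by rw [hx]; gcongr
    linarith
  have hkj : k ^ 2 ≤ j := by
    have h19 : q ≤ q ^ 19 := le_self_pow₀ (by linarith) (by norm_num)
    have : ((k ^ 2 : ℕ) : ℝ) ≤ j := by push_cast; linarith
    exact_mod_cast this
  have hT := lagPoly_turan hk hkj hx4 hxj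
  set F : ℝ := (j.factorial : ℝ) with hF
  have hF0 : 0 < F := by positivity
  have hlow : mainTerm k m (ε * b m) q (j + 1) ^ 2 -
      mainTerm k m (ε * b m) q (j + 0) * mainTerm k m (ε * b m) q (j + 2) =
      b m ^ 2 * q ^ (2 * k) * v ^ 4 * ((lagPoly k (j + 1)).eval x ^ 2 -
        (lagPoly k j).eval x * (lagPoly k (j + 2)).eval x) := by
    simp only [mainTerm, ← hx, hvx, add_zero]
    rw [pow_mul']
    linear_combination (b m ^ 2 * (q ^ k) ^ 2 * v ^ 4 * ((lagPoly k (j + 1)).eval x ^ 2 -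
        (lagPoly k j).eval x * (lagPoly k (j + 2)).eval x)) * hε
  rw [huv, hlow] at hup
  have hup2 : 4 * (F * (A * q ^ N * v) * (F * (A * q ^ N * (u * v)))) +
      (F * (A * q ^ N * (u * v))) ^ 2 ≤ F ^ 2 * v ^ 2 * (5 * (A ^ 2 * q ^ (2 * N) * u)) := by
    have : u ^ 2 ≤ u := by nlinarith
    have h5 : F ^ 2 * v ^ 2 * (A ^ 2 * q ^ (2 * N)) * u ^ 2 ≤
        F ^ 2 * v ^ 2 * (A ^ 2 * q ^ (2 * N)) * u := by gcongr
    have e : q ^ (2 * N) = (q ^ N) ^ 2 := by rw [← pow_mul]; ring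
    rw [e] at h5 ⊢
    linear_combination h5
  have hlow2 : F ^ 2 * v ^ 2 * (b m ^ 2 / (100 * (2 * Real.pi * m) ^ (2 * k) *
      (16 * q ^ 19) ^ (2 * k))) ≤ b m ^ 2 * q ^ (2 * k) * v ^ 4 *
      ((lagPoly k (j + 1)).eval x ^ 2 - (lagPoly k j).eval x * (lagPoly k (j + 2)).eval x) := by
    have h2j : 2 * (j : ℝ) + 1 ≤ 16 * q ^ 19 := by linarith
    have h1 : (1 / (16 * q ^ 19)) ^ (2 * k) ≤ (1 / (2 * (j : ℝ) + 1)) ^ (2 * k) := by gcongr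
    have hex : Real.exp x = (v ^ 2)⁻¹ := eq_inv_of_mul_eq_one_right hvx'
    calc _ = b m ^ 2 * q ^ (2 * k) * v ^ 4 * (F ^ 2 * (1 / (16 * q ^ 19)) ^ (2 * k) * Real.exp x /
          (100 * x ^ (2 * k))) := by
          rw [hex, hx, _root_.mul_pow _ q, one_div, inv_pow]
          field_simp
      _ ≤ b m ^ 2 * q ^ (2 * k) * v ^ 4 * (F ^ 2 * (1 / (2 * (j : ℝ) + 1)) ^ (2 * k) * Real.exp x /
          (100 * x ^ (2 * k))) := by gcongr
      _ ≤ _ := by gcongr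
  have hfin := le_of_mul_le_mul_left ((hlow2.trans hup).trans hup2) (by positivity)
  rw [div_le_iff₀ (by positivity)] at hfin
  have hlt := hq₂ q hqq₂
  have hue : u ≤ Real.exp (-q) := by
    apply Real.exp_le_exp.2
    nlinarith
  have : 5 * (A ^ 2 * q ^ (2 * N) * u) * (100 * (2 * Real.pi * m) ^ (2 * k) *
      (16 * q ^ 19) ^ (2 * k)) = L * (q ^ (38 * k + 2 * N) * u) := by
    rw [hL, _root_.mul_pow 16, ← pow_mul, pow_add]
    ring
  have h3 : L * (q ^ (38 * k + 2 * N) * u) ≤ L * (q ^ (38 * k + 2 * N) * Real.exp (-q)) := by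
    gcongr
  linarith

namespace IsCuspFormSL2

open UpperHalfPlane
open scoped MatrixGroups ModularForm

variable {k : ℤ} {f : ℂ → ℂ} {a : ℕ → ℂ}

lemma hasSum_update (hf : IsCuspFormSL2 k f a) {z : ℂ} (hz : 0 < z.im) :
    HasSum (fun n : ℕ => Function.update a 0 0 n * cexp (2 * Real.pi * Complex.I * n * z))
      (f z) := by
  rw [← hasSum_nat_add_iff' 1]
  simpa using hf.2.2 z hz

lemma hasSum_qParam (hf : IsCuspFormSL2 k f a) (τ : ℍ) :
    HasSum (fun n => Function.update a 0 0 n • Function.Periodic.qParam 1 τ ^ n) (f τ) := by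
  convert hf.hasSum_update τ.im_pos using 2 with n
  rw [smul_eq_mul, Function.Periodic.qParam, ← Complex.exp_nat_mul]
  congr 2
  push_cast
  ring

lemma slash_eq (hf : IsCuspFormSL2 k f a) (γ : SL(2, ℤ)) :
    (fun τ : ℍ => f τ) ∣[k] γ = fun τ : ℍ => f τ := by
  ext τ
  rw [ModularForm.slash_action_eq'_iff, coe_specialLinearGroup_apply]
  simpa [mEntry] using hf.2.1 γ τ τ.im_pos

/-- A cusp form for `SL(2, ℤ)`, as a bundled modular form of level one. -/
noncomputable def toModularForm (hf : IsCuspFormSL2 k f a) : ModularForm 𝒮ℒ k where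
  toFun τ := f τ
  slash_action_eq' := by
    rintro _ ⟨γ, rfl⟩
    exact hf.slash_eq γ
  holo' := by
    refine UpperHalfPlane.mdifferentiable_iff.mpr (hf.1.congr fun z hz => ?_)
    simp [ofComplex_apply_of_im_pos hz]
  bdd_at_cusps' hc := by
    rw [OnePoint.isBoundedAt_iff_forall_SL2Z hc]
    intro γ _
    rw [hf.slash_eq γ]
    exact isBoundedAtImInfty_of_hasSum_qExpansion one_pos hf.hasSum_qParam

lemma coeff_qExpansion (hf : IsCuspFormSL2 k f a) (n : ℕ) :
    (qExpansion 1 hf.toModularForm).coeff n = Function.update a 0 0 n :=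
  (ModularFormClass.qExpansion_coeff_unique one_pos one_mem_strictPeriods_SL
    hf.hasSum_qParam n).symm

lemma weight_pos (hf : IsCuspFormSL2 k f a) {n : ℕ} (hn : 1 ≤ n) (ha : a n ≠ 0) : 0 < k := by
  by_contra! hk
  obtain ⟨c, hc⟩ : ∃ c, ⇑hf.toModularForm = Function.const _ c := by
    rcases hk.lt_or_eq with hk | rfl
    · exact ⟨0, ModularFormClass.levelOne_neg_weight_eq_zero hk _⟩
    · exact ModularFormClass.levelOne_weight_zero_const _
  have h := ModularFormClass.qExpansion_coeff_unique (f := hf.toModularForm) (c := Pi.single 0 c)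
    one_pos one_mem_strictPeriods_SL (fun τ => by
      rw [hc]
      convert hasSum_single 0 ?_ using 1
      · simp
      · intro n hn
        simp [hn]) n
  rw [hf.coeff_qExpansion, Function.update_of_ne (by omega), Pi.single_eq_of_ne (by omega)] at h
  exact ha h.symm

lemma exists_norm_le (hf : IsCuspFormSL2 k f a) (hk : 0 ≤ k) :
    ∃ C : ℝ, ∀ n : ℕ, ‖Function.update a 0 0 n‖ ≤ C * (n : ℝ) ^ k.toNat := by
  have h := ModularFormClass.qExpansion_isBigO hk hf.toModularForm
  simp only [Subgroup.strictWidthInfty_SL2Z, hf.coeff_qExpansion] at h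
  obtain ⟨C, -, hC⟩ := bound_of_isBigO_nat_atTop h
  refine ⟨C, fun n => ?_⟩
  rw [← zpow_natCast, Int.toNat_of_nonneg hk]
  rcases eq_or_ne n 0 with rfl | hn
  · rcases hk.eq_or_lt with rfl | hk
    · simpa using hC (x := 0) (by simp)
    · simp [zero_zpow _ hk.ne']
  · have h := hC (x := n) (by positivity)
    rwa [Real.norm_of_nonneg (by positivity)] at h

lemma polyBounded_re (hf : IsCuspFormSL2 k f a) (hk : 0 ≤ k) :
    PolyBounded fun n => (Function.update a 0 0 n).re := by
  obtain ⟨C, hC⟩ := hf.exists_norm_le hk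
  exact ⟨C, k.toNat, fun n => (Complex.abs_re_le_norm _).trans (hC n)⟩

lemma polyBounded_im (hf : IsCuspFormSL2 k f a) (hk : 0 ≤ k) :
    PolyBounded fun n => (Function.update a 0 0 n).im := by
  obtain ⟨C, hC⟩ := hf.exists_norm_le hk
  exact ⟨C, k.toNat, fun n => (Complex.abs_im_le_norm _).trans (hC n)⟩

lemma hasSum_I_mul (hf : IsCuspFormSL2 k f a) {w : ℂ} (hw : 0 < w.re) :
    HasSum (fun n : ℕ => Function.update a 0 0 n * cexp (-(2 * Real.pi * n * w)))
      (f (Complex.I * w)) := by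
  convert hf.hasSum_update (z := Complex.I * w) (by simpa using hw) using 4 with n
  linear_combination -(2 * Real.pi * n * w : ℂ) * Complex.I_sq

lemma hasSum_conj (hf : IsCuspFormSL2 k f a) {w : ℂ} (hw : 0 < w.re) :
    HasSum (fun n : ℕ => starRingEnd ℂ (Function.update a 0 0 n) * cexp (-(2 * Real.pi * n * w)))
      (starRingEnd ℂ (f (Complex.I * starRingEnd ℂ w))) := by
  convert (hf.hasSum_I_mul (w := starRingEnd ℂ w) (by simpa using hw)).map
    (starRingEnd ℂ) Complex.continuous_conj using 1
  ext n
  simp [← Complex.exp_conj, Complex.conj_ofNat]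

lemma expSeries_re (hf : IsCuspFormSL2 k f a) {w : ℂ} (hw : 0 < w.re) :
    expSeries (fun n => (Function.update a 0 0 n).re) w =
      (f (Complex.I * w) + starRingEnd ℂ (f (Complex.I * starRingEnd ℂ w))) / 2 := by
  refine (((hf.hasSum_I_mul hw).add (hf.hasSum_conj hw)).div_const 2).tsum_eq ▸
    tsum_congr fun n => ?_
  rw [Complex.re_eq_add_conj]
  ring

lemma expSeries_im (hf : IsCuspFormSL2 k f a) {w : ℂ} (hw : 0 < w.re) :
    expSeries (fun n => (Function.update a 0 0 n).im) w =
      (f (Complex.I * w) - starRingEnd ℂ (f (Complex.I * starRingEnd ℂ w))) / (2 * Complex.I) := by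
  refine (((hf.hasSum_I_mul hw).sub (hf.hasSum_conj hw)).div_const (2 * Complex.I)).tsum_eq ▸
    tsum_congr fun n => ?_
  rw [Complex.im_eq_sub_conj]
  ring

lemma map_I_mul_inv (hf : IsCuspFormSL2 k f a) {w : ℂ} (hw : 0 < w.re) :
    f (Complex.I * w⁻¹) = (Complex.I * w) ^ k * f (Complex.I * w) := by
  have hw0 : w ≠ 0 := by rintro rfl; simp at hw
  have h := hf.2.1 ModularGroup.S (Complex.I * w) (by simpa using hw)
  simp only [mEntry, ModularGroup.S] at h
  simp at h
  rw [← h]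
  congr 1
  field_simp
  simp

lemma map_I_mul_inv_of_even {m : ℕ} (hf : IsCuspFormSL2 ((2 * m : ℕ) : ℤ) f a) {w : ℂ}
    (hw : 0 < w.re) :
    f (Complex.I * w⁻¹) = ((-1 : ℝ) ^ m : ℝ) * w ^ (2 * m) * f (Complex.I * w) := by
  rw [hf.map_I_mul_inv hw, zpow_natCast, _root_.mul_pow, pow_mul Complex.I, Complex.I_sq]
  push_cast
  ring

lemma conj_map_I_mul_inv_of_even {m : ℕ} (hf : IsCuspFormSL2 ((2 * m : ℕ) : ℤ) f a) {w : ℂ}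
    (hw : 0 < w.re) :
    starRingEnd ℂ (f (Complex.I * starRingEnd ℂ w⁻¹)) =
      ((-1 : ℝ) ^ m : ℝ) * w ^ (2 * m) * starRingEnd ℂ (f (Complex.I * starRingEnd ℂ w)) := by
  rw [map_inv₀, hf.map_I_mul_inv_of_even (by simpa using hw)]
  simp

lemma expSeries_re_inv {m : ℕ} (hf : IsCuspFormSL2 ((2 * m : ℕ) : ℤ) f a) {w : ℂ}
    (hw : 0 < w.re) :
    expSeries (fun n => (Function.update a 0 0 n).re) w⁻¹ = ((-1 : ℝ) ^ m : ℝ) * w ^ (2 * m) *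
      expSeries (fun n => (Function.update a 0 0 n).re) w := by
  rw [hf.expSeries_re hw, hf.expSeries_re (inv_re_pos hw), hf.map_I_mul_inv_of_even hw,
    hf.conj_map_I_mul_inv_of_even hw]
  ring

lemma expSeries_im_inv {m : ℕ} (hf : IsCuspFormSL2 ((2 * m : ℕ) : ℤ) f a) {w : ℂ}
    (hw : 0 < w.re) :
    expSeries (fun n => (Function.update a 0 0 n).im) w⁻¹ = ((-1 : ℝ) ^ m : ℝ) * w ^ (2 * m) *
      expSeries (fun n => (Function.update a 0 0 n).im) w := by
  rw [hf.expSeries_im hw, hf.expSeries_im (inv_re_pos hw), hf.map_I_mul_inv_of_even hw,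
    hf.conj_map_I_mul_inv_of_even hw]
  ring

end IsCuspFormSL2

lemma exists_neg_of_ne_zero {k : ℕ} (hk : 2 ≤ k) {b : ℕ → ℝ} (hb : PolyBounded b)
    (hb0 : b 0 = 0) (hne : ∃ n, b n ≠ 0) {ε : ℝ} (hε : ε ^ 2 = 1)
    (hmod : ∀ w : ℂ, 0 < w.re → expSeries b w⁻¹ = ε * w ^ k * expSeries b w) :
    ∃ X₀ : ℝ, 0 < X₀ ∧ ∀ X : ℝ, X₀ ≤ X →
      ∃ n : ℕ, X < n ∧ (n : ℝ) ≤ X + X ^ ((3 : ℝ) / 5) ∧ b n < 0 := by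
  classical
  obtain ⟨q₀, hq₀, h⟩ := exists_neg_of_expSeries_modular hk hb hb0
    (fun n hn => not_not.mp (Nat.find_min hne hn)) (Nat.find_spec hne) hε hmod
  refine ⟨q₀ ^ 20, by positivity, fun X hX => ?_⟩
  have hX0 : 0 < X := lt_of_lt_of_le (by positivity) hX
  obtain ⟨n, hn, hneg⟩ := h (X ^ (20⁻¹ : ℝ)) (by
    rw [Real.le_rpow_inv_iff_of_pos hq₀.le hX0.le (by norm_num)]
    exact_mod_cast hX)
  rw [mem_windowFinset, ← Real.rpow_mul_natCast hX0.le, ← Real.rpow_mul_natCast hX0.le] at hn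
  norm_num at hn
  exact ⟨n, hn.1, hn.2, hneg⟩

lemma exists_sign_changes {k : ℕ} (hk : 2 ≤ k) {b : ℕ → ℝ} (hb : PolyBounded b)
    (hb0 : b 0 = 0) (hne : ∃ n, b n ≠ 0) {ε : ℝ} (hε : ε ^ 2 = 1)
    (hmod : ∀ w : ℂ, 0 < w.re → expSeries b w⁻¹ = ε * w ^ k * expSeries b w) :
    ∃ X₀ : ℝ, 0 < X₀ ∧ ∀ X : ℝ, X₀ ≤ X →
      (∃ n : ℕ, X < n ∧ (n : ℝ) ≤ X + X ^ ((3 : ℝ) / 5) ∧ 0 < b n) ∧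
      (∃ n : ℕ, X < n ∧ (n : ℝ) ≤ X + X ^ ((3 : ℝ) / 5) ∧ b n < 0) := by
  have hneg : ∀ w, expSeries (-b) w = -expSeries b w := fun w => by
    simp [expSeries, tsum_neg]
  obtain ⟨X₁, hX₁, h₁⟩ := exists_neg_of_ne_zero hk hb hb0 hne hε hmod
  obtain ⟨X₂, hX₂, h₂⟩ := exists_neg_of_ne_zero (b := -b) hk
    (by simpa [PolyBounded] using hb) (by simp [hb0]) (by simpa using hne) hε
    (fun w hw => by rw [hneg, hneg, hmod w hw]; ring)
  refine ⟨max X₁ X₂, by positivity, fun X hX => ⟨?_, h₁ X ((le_max_left _ _).trans hX)⟩⟩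
  simpa using h₂ X ((le_max_right _ _).trans hX)

lemma delCoeff_re (k : ℤ) (a : ℕ → ℂ) (n : ℕ) :
    (delCoeff k a n).re = (a n).re * (n : ℝ) ^ (-(((k : ℝ) - 1) / 2)) := by
  rw [delCoeff, Complex.re_mul_ofReal]

lemma delCoeff_im (k : ℤ) (a : ℕ → ℂ) (n : ℕ) :
    (delCoeff k a n).im = (a n).im * (n : ℝ) ^ (-(((k : ℝ) - 1) / 2)) := by
  rw [delCoeff, Complex.im_mul_ofReal]

lemma exists_sign_changes_mul_rpow {b d : ℕ → ℝ} {s : ℝ}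
    (hd : ∀ n, 1 ≤ n → d n = b n * (n : ℝ) ^ s)
    (h : ∃ X₀ : ℝ, 0 < X₀ ∧ ∀ X : ℝ, X₀ ≤ X →
      (∃ n : ℕ, X < n ∧ (n : ℝ) ≤ X + X ^ ((3 : ℝ) / 5) ∧ 0 < b n) ∧
      (∃ n : ℕ, X < n ∧ (n : ℝ) ≤ X + X ^ ((3 : ℝ) / 5) ∧ b n < 0)) :
    ∃ X₀ : ℝ, 0 < X₀ ∧ ∀ X : ℝ, X₀ ≤ X →
      (∃ n : ℕ, X < n ∧ (n : ℝ) ≤ X + X ^ ((3 : ℝ) / 5) ∧ 0 < d n) ∧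
      (∃ n : ℕ, X < n ∧ (n : ℝ) ≤ X + X ^ ((3 : ℝ) / 5) ∧ d n < 0) := by
  obtain ⟨X₀, hX₀, h⟩ := h
  refine ⟨X₀, hX₀, fun X hX => ?_⟩
  have hpos : ∀ n : ℕ, X < n → 0 < n := fun n hn => by
    exact_mod_cast (hX₀.trans_le hX).trans hn
  obtain ⟨⟨n, hn, hn', hbn⟩, m, hm, hm', hbm⟩ := h X hX
  refine ⟨⟨n, hn, hn', ?_⟩, m, hm, hm', ?_⟩
  · have := hpos n hn
    rw [hd n this]
    positivity
  · have := hpos m hm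
    rw [hd m this]
    exact mul_neg_of_neg_of_pos hbm (by positivity)

/-- Sign changes of the real (resp. imaginary) parts of the Deligne-normalized
coefficients of a cusp form of even weight for `SL(2, ℤ)` in every interval
`(X, X + X^{3/5}]` for `X` large, provided some coefficient has nonzero real
(resp. imaginary) part. -/
theorem stmt_9 (k : ℤ) (hk : Even k) (f : ℂ → ℂ) (a : ℕ → ℂ)
    (hf : IsCuspFormSL2 k f a) :
    ((∃ n : ℕ, 1 ≤ n ∧ (delCoeff k a n).re ≠ 0) →
      ∃ X₀ : ℝ, 0 < X₀ ∧ ∀ X : ℝ, X₀ ≤ X →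
        (∃ n : ℕ, (X : ℝ) < n ∧ (n : ℝ) ≤ X + X ^ ((3 : ℝ) / 5) ∧ 0 < (delCoeff k a n).re) ∧
        (∃ m : ℕ, (X : ℝ) < m ∧ (m : ℝ) ≤ X + X ^ ((3 : ℝ) / 5) ∧ (delCoeff k a m).re < 0)) ∧
    ((∃ n : ℕ, 1 ≤ n ∧ (delCoeff k a n).im ≠ 0) →
      ∃ X₀ : ℝ, 0 < X₀ ∧ ∀ X : ℝ, X₀ ≤ X →
        (∃ n : ℕ, (X : ℝ) < n ∧ (n : ℝ) ≤ X + X ^ ((3 : ℝ) / 5) ∧ 0 < (delCoeff k a n).im) ∧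
        (∃ m : ℕ, (X : ℝ) < m ∧ (m : ℝ) ≤ X + X ^ ((3 : ℝ) / 5) ∧ (delCoeff k a m).im < 0)) := by
  have hkm : ∀ n, 1 ≤ n → a n ≠ 0 → ∃ m : ℕ, 1 ≤ m ∧ k = ((2 * m : ℕ) : ℤ) := by
    intro n hn ha
    have hpos := hf.weight_pos hn ha
    obtain ⟨j, rfl⟩ := hk
    exact ⟨j.toNat, by omega, by omega⟩
  constructor
  · rintro ⟨n, hn, hne⟩
    have ha : (a n).re ≠ 0 := left_ne_zero_of_mul (delCoeff_re k a n ▸ hne)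
    obtain ⟨m, hm, rfl⟩ := hkm n hn (fun h => ha (by simp [h]))
    refine exists_sign_changes_mul_rpow (s := -((((2 * m : ℕ) : ℤ) - 1) / 2))
      (b := fun n => (Function.update a 0 0 n).re) (fun n hn => ?_)
      (exists_sign_changes (k := 2 * m) (by omega) (hf.polyBounded_re (by positivity))
        (by simp) ⟨n, ?_⟩ (ε := (-1) ^ m) (by rw [← pow_mul, mul_comm, pow_mul]; simp)
        fun w hw => hf.expSeries_re_inv hw)
    · rw [delCoeff_re, Function.update_of_ne (by omega)]
    · rwa [Function.update_of_ne (by omega)]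
  · rintro ⟨n, hn, hne⟩
    have ha : (a n).im ≠ 0 := left_ne_zero_of_mul (delCoeff_im k a n ▸ hne)
    obtain ⟨m, hm, rfl⟩ := hkm n hn (fun h => ha (by simp [h]))
    refine exists_sign_changes_mul_rpow (s := -((((2 * m : ℕ) : ℤ) - 1) / 2))
      (b := fun n => (Function.update a 0 0 n).im) (fun n hn => ?_)
      (exists_sign_changes (k := 2 * m) (by omega) (hf.polyBounded_im (by positivity))
        (by simp) ⟨n, ?_⟩ (ε := (-1) ^ m) (by rw [← pow_mul, mul_comm, pow_mul]; simp)
        fun w hw => hf.expSeries_im_inv hw)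
    · rw [delCoeff_im, Function.update_of_ne (by omega)]
    · rwa [Function.update_of_ne (by omega)]
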